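/- arXiv:1702.07041 — 7 statements merged into one kernel-verified Lean document; each statement's English description precedes it below -/
import Mathlib

section
/- Let κ be a regular cardinal and let d = ⟨d_α : α<κ⟩ be a κ-list. Then d splits every unbounded subset of κ into unbounded sets if and only if d does not have a cofinal branch. -/
open Cardinal Set

/-- A `κ`-list: a sequence `⟨d_α : α < κ⟩` with `d_α ⊆ α`. -/
def IsKappaList (κo : Ordinal) (d : Ordinal → Set Ordinal) : Prop :=
  ∀ α < κo, d α ⊆ Set.Iio α

/-- `A` is an unbounded subset of `κ`. -/
def UnbddIn (κo : Ordinal) (A : Set Ordinal) : Prop :=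
  A ⊆ Set.Iio κo ∧ ∀ γ < κo, ∃ α ∈ A, γ ≤ α

/-- Fewer than `κ` many ordinals below a regular cardinal `κ` have a strict upper bound below `κ`. -/
theorem exists_strict_bound_of_isRegular {κ : Cardinal} (hreg : κ.IsRegular) {γ : Ordinal}
    (hγ : γ < κ.ord) (g : Ordinal → Ordinal) (hg : ∀ β < γ, g β < κ.ord) :
    ∃ δ < κ.ord, ∀ β < γ, g β < δ := by
  refine ⟨⨆ i : Set.Iio γ, g i + 1, ?_, fun β hβ =>
    Ordinal.lt_iSup_add_one (fun i : Set.Iio γ => g i) ⟨β, hβ⟩⟩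
  refine Ordinal.lift_iSup_add_one_lt_of_lt_cof ?_ fun i => hg i i.2
  rw [← Ordinal.lift_cof, hreg.cof_ord, Cardinal.mk_Iio_ordinal, Cardinal.lift_lift,
    Cardinal.lift_lt]
  exact Cardinal.lt_ord.1 hγ

theorem exists_bound_of_not_unbddIn {κo : Ordinal} {A : Set Ordinal} (hA : A ⊆ Set.Iio κo)
    (h : ¬ UnbddIn κo A) : ∃ γ < κo, ∀ α ∈ A, α < γ := by
  by_contra! hc
  exact h ⟨hA, hc⟩

/-- A cofinal branch yields an unbounded set whose elements eventually decide membership of each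
`β` the way the branch does. -/
theorem exists_unbddIn_not_split_of_branch {κ : Cardinal} (hreg : κ.IsRegular)
    {d : Ordinal → Set Ordinal} {b : Set Ordinal}
    (hb : ∀ γ < κ.ord, ∃ α, γ ≤ α ∧ α < κ.ord ∧ d α ∩ Set.Iio γ = b ∩ Set.Iio γ) :
    ∃ A, UnbddIn κ.ord A ∧
      ∀ β < κ.ord, ∃ δ < κ.ord, ∀ α ∈ A, δ ≤ α → (β ∈ d α ↔ β ∈ b) := by
  choose! f hle hlt heq using hb
  refine ⟨f '' Set.Iio κ.ord, ⟨?_, fun γ hγ => ⟨f γ, ⟨γ, hγ, rfl⟩, hle γ hγ⟩⟩, fun β hβ => ?_⟩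
  · rintro _ ⟨γ, hγ, rfl⟩
    exact hlt γ hγ
  have hβ' : Order.succ β < κ.ord :=
    (Cardinal.isSuccLimit_ord hreg.aleph0_le).succ_lt hβ
  obtain ⟨δ, hδ, hδf⟩ := exists_strict_bound_of_isRegular hreg hβ' f
    fun γ hγ => hlt γ (hγ.trans hβ')
  refine ⟨δ, hδ, ?_⟩
  rintro _ ⟨γ, hγ, rfl⟩ hδγ
  have hβγ : β < γ := by
    by_contra! hγβ
    exact (hδf γ (Order.lt_succ_of_le hγβ)).not_ge hδγ
  simpa [hβγ] using Set.ext_iff.1 (heq γ hγ) β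

/-- An unbounded set that is not split by any `β` yields a cofinal branch. -/
theorem exists_branch_of_not_split {κ : Cardinal} (hreg : κ.IsRegular)
    {d : Ordinal → Set Ordinal} {A : Set Ordinal} (hA : UnbddIn κ.ord A)
    (hsplit : ∀ β < κ.ord, UnbddIn κ.ord {α | α ∈ A ∧ β ∈ d α} →
      ¬ UnbddIn κ.ord {α | α ∈ A ∧ β < α ∧ β ∉ d α}) :
    ∃ b : Set Ordinal, b ⊆ Set.Iio κ.ord ∧
      ∀ γ < κ.ord, ∃ α, γ ≤ α ∧ α < κ.ord ∧ d α ∩ Set.Iio γ = b ∩ Set.Iio γ := by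
  let b : Set Ordinal := {β | β < κ.ord ∧ UnbddIn κ.ord {α | α ∈ A ∧ β ∈ d α}}
  have hdecide : ∀ β < κ.ord, ∃ δ < κ.ord, ∀ α ∈ A, δ ≤ α → β < α → (β ∈ d α ↔ β ∈ b) := by
    intro β hβ
    by_cases hpos : UnbddIn κ.ord {α | α ∈ A ∧ β ∈ d α}
    · obtain ⟨δ, hδ, hbd⟩ := exists_bound_of_not_unbddIn (fun α hα => hA.1 hα.1)
        (hsplit β hβ hpos)
      refine ⟨δ, hδ, fun α hα hδα hβα => iff_of_true ?_ ⟨hβ, hpos⟩⟩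
      by_contra hn
      exact (hbd α ⟨hα, hβα, hn⟩).not_ge hδα
    · obtain ⟨δ, hδ, hbd⟩ := exists_bound_of_not_unbddIn (fun α hα => hA.1 hα.1) hpos
      exact ⟨δ, hδ, fun α hα hδα _ =>
        iff_of_false (fun hm => (hbd α ⟨hα, hm⟩).not_ge hδα) fun hm => hpos hm.2⟩
  choose! g hg hgb using hdecide
  refine ⟨b, fun β hβ => hβ.1, fun γ hγ => ?_⟩
  obtain ⟨δ, hδ, hgδ⟩ := exists_strict_bound_of_isRegular hreg hγ g
    fun β hβ => hg β (hβ.trans hγ)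
  obtain ⟨α, hα, hmax⟩ := hA.2 (max γ δ) (max_lt hγ hδ)
  have hγα : γ ≤ α := (le_max_left _ _).trans hmax
  refine ⟨α, hγα, hA.1 hα, ?_⟩
  ext β
  refine and_congr_left fun hβ : β < γ => ?_
  exact hgb β (hβ.trans hγ) α hα ((hgδ β hβ).le.trans ((le_max_right _ _).trans hmax))
    (hβ.trans_le hγα)

/-- For regular `κ`, a `κ`-list `d` splits every unbounded subset of `κ` into unbounded
sets if and only if `d` has no cofinal branch. -/
theorem splits_unbounded_iff_no_cofinal_branch (κ : Cardinal) (hreg : κ.IsRegular)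
    (d : Ordinal → Set Ordinal) (hd : IsKappaList κ.ord d) :
    (∀ A : Set Ordinal, UnbddIn κ.ord A →
        ∃ β < κ.ord, UnbddIn κ.ord {α | α ∈ A ∧ β ∈ d α} ∧
          UnbddIn κ.ord {α | α ∈ A ∧ β < α ∧ β ∉ d α}) ↔
      ¬ ∃ b : Set Ordinal, b ⊆ Set.Iio κ.ord ∧
          ∀ γ < κ.ord, ∃ α, γ ≤ α ∧ α < κ.ord ∧ d α ∩ Set.Iio γ = b ∩ Set.Iio γ := by
  constructor
  · rintro h ⟨b, -, hb⟩
    obtain ⟨A, hA, hdec⟩ := exists_unbddIn_not_split_of_branch hreg hb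
    obtain ⟨β, hβ, hpos, hneg⟩ := h A hA
    obtain ⟨δ, hδ, hdec⟩ := hdec β hβ
    obtain ⟨α, ⟨hα, hmem⟩, hδα⟩ := hpos.2 δ hδ
    obtain ⟨α', ⟨hα', -, hnot⟩, hδα'⟩ := hneg.2 δ hδ
    exact hnot ((hdec α' hα' hδα').2 ((hdec α hα hδα).1 hmem))
  · intro h A hA
    by_contra! hc
    exact h (exists_branch_of_not_split hreg hA hc)
end

section
/- Let κ be a regular cardinal. Then Sp(κ)(unbounded) holds if and only if there is a downward-closed subtree T of 2^{<κ} (i.e., a set of binary sequences of length <κ closed under initial segments) containing a node of every length <κ, such that T has no cofinal branch, i.e., no function b : κ → 2 with b↾γ ∈ T for every γ<κ. -/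
open Cardinal Set

/-- `Sp(κ)(unbounded)`: there is a `κ`-list splitting every unbounded subset of `κ`
into unbounded sets. -/
def SpUnbdd (κ : Cardinal) : Prop :=
  ∃ d : Ordinal → Set Ordinal, IsKappaList κ.ord d ∧
    ∀ A : Set Ordinal, UnbddIn κ.ord A →
      ∃ β < κ.ord, UnbddIn κ.ord {α | α ∈ A ∧ β ∈ d α} ∧
        UnbddIn κ.ord {α | α ∈ A ∧ β < α ∧ β ∉ d α}

/-- Fewer than `κ` many ordinals below a regular `κ` have a common bound below `κ`. -/
theorem Cardinal.IsRegular.exists_forall_lt_le {κ : Cardinal} (hreg : κ.IsRegular)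
    {γ : Ordinal} (hγ : γ < κ.ord) {f : Ordinal → Ordinal} (hf : ∀ β < γ, f β < κ.ord) :
    ∃ δ < κ.ord, ∀ β < γ, f β ≤ δ := by
  have hcard : #γ.ToType < κ.ord.cof := by
    rw [hreg.cof_ord, mk_toType]
    exact lt_ord.1 hγ
  let e : γ.ToType ≃o Iio γ := Ordinal.ToType.mk.symm
  refine ⟨⨆ i, f (e i), Ordinal.iSup_lt_of_lt_cof hcard fun i => hf _ (e i).2, fun β hβ => ?_⟩
  simpa using Ordinal.le_iSup (fun i => f (e i)) (e.symm ⟨β, hβ⟩)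

/-- If no coordinate splits the unbounded set `A`, then the `d α` with `α ∈ A` converge
to a single set `b`. -/
theorem exists_forall_inter_Iio_eq {κ : Cardinal} (hreg : κ.IsRegular) {d : Ordinal → Set Ordinal}
    {A : Set Ordinal} (hA : UnbddIn κ.ord A)
    (hsplit : ∀ β < κ.ord, UnbddIn κ.ord {α | α ∈ A ∧ β ∈ d α} →
      ¬ UnbddIn κ.ord {α | α ∈ A ∧ β < α ∧ β ∉ d α}) :
    ∃ b : Set Ordinal, ∀ γ < κ.ord, ∃ α ∈ A, γ ≤ α ∧ d α ∩ Iio γ = b ∩ Iio γ := by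
  let b : Set Ordinal := {β | UnbddIn κ.ord {α | α ∈ A ∧ β ∈ d α}}
  have hstable : ∀ β < κ.ord, ∃ δ < κ.ord, ∀ α ∈ A, δ ≤ α → β < α → (β ∈ d α ↔ β ∈ b) := by
    intro β hβ
    by_cases hb : β ∈ b
    · have hminus := hsplit β hβ hb
      simp only [UnbddIn, not_and, not_forall, not_exists, not_le] at hminus
      obtain ⟨δ, hδ, hlt⟩ := hminus fun α hα => hA.1 hα.1
      refine ⟨δ, hδ, fun α hα hle hβα => ⟨fun _ => hb, fun _ => ?_⟩⟩
      by_contra hnot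
      exact (hlt α ⟨hα, hβα, hnot⟩).not_ge hle
    · have hplus : ¬ UnbddIn κ.ord {α | α ∈ A ∧ β ∈ d α} := hb
      simp only [UnbddIn, not_and, not_forall, not_exists, not_le] at hplus
      obtain ⟨δ, hδ, hlt⟩ := hplus fun α hα => hA.1 hα.1
      exact ⟨δ, hδ, fun α hα hle _ =>
        ⟨fun hmem => absurd hle (hlt α ⟨hα, hmem⟩).not_ge, fun hmem => absurd hmem hb⟩⟩
  choose! f hf hfb using hstable
  refine ⟨b, fun γ hγ => ?_⟩
  obtain ⟨δ, hδ, hle⟩ := hreg.exists_forall_lt_le hγ fun β hβ => hf β (hβ.trans hγ)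
  obtain ⟨α, hα, hmax⟩ := hA.2 (max γ δ) (max_lt hγ hδ)
  have hγα : γ ≤ α := (le_max_left _ _).trans hmax
  refine ⟨α, hα, hγα, ?_⟩
  ext β
  refine and_congr_left fun hβ => ?_
  exact hfb β (hβ.trans hγ) α hα ((hle β hβ).trans ((le_max_right _ _).trans hmax))
    (hβ.trans_le hγα)

/-- For regular `κ`, `Sp(κ)(unbounded)` holds iff there is a downward-closed subtree of
`2^{<κ}` (nodes of length `γ` are coded as subsets of `γ`, paired with their length)
containing a node of every length `< κ`, with no cofinal branch. -/
theorem sp_unbounded_iff_tree_without_branch (κ : Cardinal) (hreg : κ.IsRegular) :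
    SpUnbdd κ ↔
      ∃ T : Set (Ordinal × Set Ordinal),
        (∀ p ∈ T, p.1 < κ.ord ∧ p.2 ⊆ Set.Iio p.1) ∧
        (∀ p ∈ T, ∀ γ ≤ p.1, (γ, p.2 ∩ Set.Iio γ) ∈ T) ∧
        (∀ γ < κ.ord, ∃ s : Set Ordinal, (γ, s) ∈ T) ∧
        ¬ ∃ b : Set Ordinal, ∀ γ < κ.ord, (γ, b ∩ Set.Iio γ) ∈ T := by
  constructor
  · rintro ⟨d, -, hsplit⟩
    refine ⟨{p | ∃ α < κ.ord, p.1 ≤ α ∧ p.2 = d α ∩ Iio p.1}, ?_, ?_, ?_, ?_⟩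
    · rintro ⟨γ, s⟩ ⟨α, hα, hγα, hs⟩
      exact ⟨hγα.trans_lt hα, hs.trans_subset inter_subset_right⟩
    · rintro ⟨γ, s⟩ ⟨α, hα, hγα, hs⟩ γ' hγ'
      refine ⟨α, hα, hγ'.trans hγα, ?_⟩
      simp only at hs hγ' ⊢
      rw [hs, inter_assoc, Iio_inter_Iio, inf_eq_right.2 hγ']
    · exact fun γ hγ => ⟨d γ ∩ Iio γ, γ, hγ, le_rfl, rfl⟩
    · rintro ⟨b, hb⟩
      choose! a haκ hle heq using hb
      have hA : UnbddIn κ.ord (a '' Iio κ.ord) :=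
        ⟨image_subset_iff.2 haκ, fun γ hγ => ⟨a γ, mem_image_of_mem a hγ, hle γ hγ⟩⟩
      obtain ⟨β, hβ, hplus, hminus⟩ := hsplit _ hA
      have hlim := isSuccLimit_ord hreg.aleph0_le
      obtain ⟨δ, hδ, hbound⟩ := hreg.exists_forall_lt_le (hlim.succ_lt hβ)
        fun γ hγ => haκ γ (hγ.trans (hlim.succ_lt hβ))
      have hagree : ∀ γ < κ.ord, Order.succ δ ≤ a γ → (β ∈ b ↔ β ∈ d (a γ)) := by
        intro γ hγ hδγ
        have hβγ : β < γ := by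
          by_contra! hγβ
          exact ((Order.succ_le_iff.1 hδγ).trans_le
            (hbound γ (Order.lt_succ_iff.2 hγβ))).false
        simpa [hβγ] using Set.ext_iff.1 (heq γ hγ) β
      obtain ⟨_, ⟨⟨γ, hγ, rfl⟩, hmem⟩, hδγ⟩ := hplus.2 _ (hlim.succ_lt hδ)
      obtain ⟨_, ⟨⟨γ', hγ', rfl⟩, -, hnot⟩, hδγ'⟩ := hminus.2 _ (hlim.succ_lt hδ)
      exact hnot ((hagree γ' hγ' hδγ').1 ((hagree γ hγ hδγ).2 hmem))
  · rintro ⟨T, hT, hdown, hlevel, hbranch⟩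
    choose! d hd using hlevel
    refine ⟨d, fun α hα => (hT _ (hd α hα)).2, fun A hA => ?_⟩
    by_contra! hsplit
    obtain ⟨b, hb⟩ := exists_forall_inter_Iio_eq hreg hA hsplit
    refine hbranch ⟨b, fun γ hγ => ?_⟩
    obtain ⟨α, hα, hγα, heq⟩ := hb γ hγ
    exact heq ▸ hdown _ (hd α (hA.1 hα)) γ hγα
end

section
/- Let κ be a cardinal, 𝒜 a family of subsets of κ, and d a κ-list. Then d splits every A ∈ 𝒜 into nonempty sets if and only if d has no 𝒜-branch. Consequently, a regular uncountable cardinal κ is 𝒜-ineffable if and only if Sp(κ)(𝒜, nonempty) fails. -/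
open Cardinal Set

/-- A `κ`-list splits a set `A ⊆ κ` into nonempty sets iff no set `b` is guessed correctly by the
list at every element of `A`. -/
theorem IsKappaList.splits_nonempty_iff {κo : Ordinal} {d : Ordinal → Set Ordinal}
    (hd : IsKappaList κo d) {A : Set Ordinal} (hA : A ⊆ Set.Iio κo) :
    (∃ β < κo, {α | α ∈ A ∧ β ∈ d α}.Nonempty ∧ {α | α ∈ A ∧ β < α ∧ β ∉ d α}.Nonempty) ↔
      ¬ ∃ b : Set Ordinal, ∀ α ∈ A, d α = b ∩ Set.Iio α := by
  constructor
  · rintro ⟨β, -, ⟨γ, hγ, hβγ⟩, δ, hδ, hβδ, hβ⟩ ⟨b, hb⟩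
    rw [hb γ hγ] at hβγ
    rw [hb δ hδ] at hβ
    exact hβ ⟨hβγ.1, hβδ⟩
  · intro h
    by_contra hsplit
    refine h ⟨⋃ α ∈ A, d α, fun α hα ↦ Set.Subset.antisymm
      (fun β hβ ↦ ⟨Set.mem_biUnion hα hβ, hd α (hA hα) hβ⟩) ?_⟩
    rintro β ⟨hβ, hβα⟩
    obtain ⟨γ, hγ, hβγ⟩ := Set.mem_iUnion₂.1 hβ
    by_contra hβd
    exact hsplit ⟨β, lt_trans hβα (hA hα), ⟨γ, hγ, hβγ⟩, α, hα, hβα, hβd⟩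

/-- A `κ`-list splits every member of a family of subsets of `κ` into nonempty sets iff it has no
branch through that family. -/
theorem IsKappaList.forall_splits_nonempty_iff {κo : Ordinal} {d : Ordinal → Set Ordinal}
    (hd : IsKappaList κo d) {𝒜 : Set (Set Ordinal)} (h𝒜 : ∀ A ∈ 𝒜, A ⊆ Set.Iio κo) :
    (∀ A ∈ 𝒜, ∃ β < κo, {α | α ∈ A ∧ β ∈ d α}.Nonempty ∧
        {α | α ∈ A ∧ β < α ∧ β ∉ d α}.Nonempty) ↔
      ¬ ∃ b : Set Ordinal, ∃ A ∈ 𝒜, ∀ α ∈ A, d α = b ∩ Set.Iio α := by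
  rw [forall₂_congr fun A hA ↦ hd.splits_nonempty_iff (h𝒜 A hA)]
  exact ⟨fun h ⟨b, A, hA, hb⟩ ↦ h A hA ⟨b, hb⟩, fun h A hA ⟨b, hb⟩ ↦ h ⟨b, A, hA, hb⟩⟩

/-- A `κ`-list `d` splits every `A ∈ 𝒜` into nonempty sets iff `d` has no `𝒜`-branch.
Consequently, a regular uncountable `κ` is `𝒜`-ineffable iff `Sp(κ)(𝒜, nonempty)` fails. -/
theorem splits_nonempty_iff_no_branch (κ : Cardinal) (𝒜 : Set (Set Ordinal))
    (h𝒜 : ∀ A ∈ 𝒜, A ⊆ Set.Iio κ.ord)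
    (d : Ordinal → Set Ordinal) (hd : IsKappaList κ.ord d) :
    ((∀ A ∈ 𝒜, ∃ β < κ.ord, {α | α ∈ A ∧ β ∈ d α}.Nonempty ∧
        {α | α ∈ A ∧ β < α ∧ β ∉ d α}.Nonempty) ↔
      ¬ ∃ b : Set Ordinal, ∃ A ∈ 𝒜, ∀ α ∈ A, d α = b ∩ Set.Iio α)
    ∧ (ℵ₀ < κ → κ.IsRegular →
        ((∀ e : Ordinal → Set Ordinal, IsKappaList κ.ord e →
            ∃ b : Set Ordinal, ∃ A ∈ 𝒜, ∀ α ∈ A, e α = b ∩ Set.Iio α) ↔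
          ¬ ∃ e : Ordinal → Set Ordinal, IsKappaList κ.ord e ∧
              ∀ A ∈ 𝒜, ∃ β < κ.ord, {α | α ∈ A ∧ β ∈ e α}.Nonempty ∧
                {α | α ∈ A ∧ β < α ∧ β ∉ e α}.Nonempty)) := by
  refine ⟨hd.forall_splits_nonempty_iff h𝒜, fun _ _ ↦ ⟨?_, fun h e he ↦ ?_⟩⟩
  · rintro h ⟨e, he, hsplit⟩
    exact (he.forall_splits_nonempty_iff h𝒜).1 hsplit (h e he)
  · by_contra hbranch
    exact h ⟨e, he, (he.forall_splits_nonempty_iff h𝒜).2 hbranch⟩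
end

section
/- Let κ be a cardinal and let 𝒜, ℬ be families of subsets of κ such that 𝒜 = I⁺ is the collection of I-positive sets for some ideal I on κ, and ℬ is closed under supersets. Then the collection 𝓘(Sp(κ)(𝒜,ℬ)) = {A ⊆ κ : Sp(κ)(𝒜↾A, ℬ) holds} is an ideal on κ (it is closed under subsets and under finite unions). -/
open Cardinal Set

/-- `Sp(κ)(𝒜↾A, ℬ)`: there is a `κ`-list splitting every member of `𝒜` contained in `A`
into sets in `ℬ`. -/
def SpRestrict (κ : Cardinal) (𝒜 ℬ : Set (Set Ordinal)) (A : Set Ordinal) : Prop :=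
  ∃ d : Ordinal → Set Ordinal, IsKappaList κ.ord d ∧
    ∀ X ∈ 𝒜, X ⊆ A → ∃ β < κ.ord,
      {α | α ∈ X ∧ β ∈ d α} ∈ ℬ ∧ {α | α ∈ X ∧ β < α ∧ β ∉ d α} ∈ ℬ

/-- The `I`-positive sets: subsets of `κ` not in `I`. -/
def posSets (κ : Cardinal) (I : Set (Set Ordinal)) : Set (Set Ordinal) :=
  {X | X ⊆ Set.Iio κ.ord ∧ X ∉ I}

/-- The split ideal `𝓘(Sp(κ)(𝒜,ℬ)) = {A ⊆ κ : Sp(κ)(𝒜↾A, ℬ)}`. -/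
def splitIdeal (κ : Cardinal) (𝒜 ℬ : Set (Set Ordinal)) : Set (Set Ordinal) :=
  {A | A ⊆ Set.Iio κ.ord ∧ SpRestrict κ 𝒜 ℬ A}

/-- If `𝒜 = I⁺` for an ideal `I` on `κ` and `ℬ` is closed under supersets, then
`𝓘(Sp(κ)(𝒜,ℬ))` is an ideal on `κ`: closed under subsets and finite unions. -/
theorem splitIdeal_isIdeal (κ : Cardinal) (I : Set (Set Ordinal))
    (hIsub : ∀ X ∈ I, X ⊆ Set.Iio κ.ord)
    (hIdown : ∀ X Y : Set Ordinal, X ⊆ Y → Y ∈ I → X ∈ I)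
    (hIunion : ∀ X ∈ I, ∀ Y ∈ I, X ∪ Y ∈ I)
    (ℬ : Set (Set Ordinal))
    (hℬ : ∀ B ∈ ℬ, ∀ C : Set Ordinal, B ⊆ C → C ⊆ Set.Iio κ.ord → C ∈ ℬ) :
    (∀ A B : Set Ordinal, A ⊆ B → B ∈ splitIdeal κ (posSets κ I) ℬ →
        A ∈ splitIdeal κ (posSets κ I) ℬ) ∧
    (∀ A ∈ splitIdeal κ (posSets κ I) ℬ, ∀ B ∈ splitIdeal κ (posSets κ I) ℬ,
        A ∪ B ∈ splitIdeal κ (posSets κ I) ℬ) := by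
  classical
  refine ⟨?_, ?_⟩
  · rintro A B hAB ⟨hB, d, hd, h⟩
    exact ⟨hAB.trans hB, d, hd, fun X hX hXA => h X hX (hXA.trans hAB)⟩
  · rintro A ⟨hA, dA, hdA, hspA⟩ B ⟨hB, dB, hdB, hspB⟩
    refine ⟨union_subset hA hB, fun α => if α ∈ A then dA α else dB α, ?_, ?_⟩
    · intro α hα
      dsimp only
      split_ifs
      exacts [hdA α hα, hdB α hα]
    · rintro X ⟨hXκ, hXI⟩ hXAB
      by_cases hXA : X ∩ A ∈ I
      · have hpos : X \ A ∉ I := fun hdiff =>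
          hXI (inter_union_sdiff X A ▸ hIunion _ hXA _ hdiff)
        obtain ⟨β, hβ, hin, hout⟩ := hspB (X \ A) ⟨sdiff_subset.trans hXκ, hpos⟩
          (sdiff_subset_iff.2 hXAB)
        refine ⟨β, hβ, hℬ _ hin _ ?_ fun α hα => hXκ hα.1,
          hℬ _ hout _ ?_ fun α hα => hXκ hα.1⟩
        · rintro α ⟨⟨hαX, hαA⟩, hα⟩
          simpa [hαX, hαA] using hα
        · rintro α ⟨⟨hαX, hαA⟩, hα⟩
          simpa [hαX, hαA] using hα
      · obtain ⟨β, hβ, hin, hout⟩ := hspA (X ∩ A) ⟨inter_subset_left.trans hXκ, hXA⟩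
          inter_subset_right
        refine ⟨β, hβ, hℬ _ hin _ ?_ fun α hα => hXκ hα.1,
          hℬ _ hout _ ?_ fun α hα => hXκ hα.1⟩
        · rintro α ⟨⟨hαX, hαA⟩, hα⟩
          simpa [hαX, hαA] using hα
        · rintro α ⟨⟨hαX, hαA⟩, hα⟩
          simpa [hαX, hαA] using hα
end

section
/- Let κ be a regular uncountable cardinal, λ ≥ κ a cardinal, and d a P_κλ-list. The following are equivalent: (1) d splits every stationary subset of P_κλ into stationary sets; (2) d splits every stationary subset into unbounded sets; (3) d splits every stationary subset into covering sets; (4) d splits every stationary subset into nonempty sets; (5) d has no ineffable branch. -/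
open Cardinal Set

/-- `P_κλ`: the collection of subsets of `λ` of size less than `κ`. -/
def Pkl (κ lam : Cardinal) : Set (Set Ordinal) :=
  {x | x ⊆ Set.Iio lam.ord ∧ Cardinal.mk ↥x < Cardinal.lift.{1,0} κ}

/-- `U` is an unbounded (cofinal) subset of `P_κλ`. -/
def PklUnbdd (κ lam : Cardinal) (U : Set (Set Ordinal)) : Prop :=
  U ⊆ Pkl κ lam ∧ ∀ x ∈ Pkl κ lam, ∃ y ∈ U, x ⊆ y

/-- `C` is a club subset of `P_κλ`: unbounded and closed under unions of ⊆-increasing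
chains of length `< κ`. -/
def PklClub (κ lam : Cardinal) (C : Set (Set Ordinal)) : Prop :=
  PklUnbdd κ lam C ∧
    ∀ o : Ordinal, 0 < o → o < κ.ord →
      ∀ c : Ordinal → Set Ordinal,
        (∀ i < o, c i ∈ C) → (∀ i j : Ordinal, i ≤ j → j < o → c i ⊆ c j) →
        (⋃ i ∈ Set.Iio o, c i) ∈ C

/-- `S` is a stationary subset of `P_κλ`: it meets every club. -/
def PklStat (κ lam : Cardinal) (S : Set (Set Ordinal)) : Prop :=
  S ⊆ Pkl κ lam ∧ ∀ C, PklClub κ lam C → (S ∩ C).Nonempty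

/-- `A` is covering: `⋃ A = λ`. -/
def PklCovering (lam : Cardinal) (A : Set (Set Ordinal)) : Prop :=
  ∀ ξ < lam.ord, ∃ x ∈ A, ξ ∈ x

theorem Pkl.biUnion_mem {κ lam : Cardinal} (hreg : κ.IsRegular) {s : Set Ordinal}
    (hs : #s < Cardinal.lift.{1, 0} κ) {t : Ordinal → Set Ordinal}
    (ht : ∀ i ∈ s, t i ∈ Pkl κ lam) : (⋃ i ∈ s, t i) ∈ Pkl κ lam :=
  ⟨iUnion₂_subset fun i hi => (ht i hi).1,
    (card_biUnion_lt_iff_forall_of_isRegular hreg.lift hs).2 fun i hi => (ht i hi).2⟩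

theorem Pkl.union_mem {κ lam : Cardinal} (hreg : κ.IsRegular) {x y : Set Ordinal}
    (hx : x ∈ Pkl κ lam) (hy : y ∈ Pkl κ lam) : x ∪ y ∈ Pkl κ lam :=
  ⟨union_subset hx.1 hy.1,
    (mk_union_le x y).trans_lt (add_lt_of_lt hreg.lift.aleph0_le hx.2 hy.2)⟩

theorem Pkl.singleton_mem {κ lam : Cardinal} (hreg : κ.IsRegular) {ξ : Ordinal}
    (hξ : ξ < lam.ord) : {ξ} ∈ Pkl κ lam := by
  refine ⟨singleton_subset_iff.2 hξ, ?_⟩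
  rw [mk_singleton]
  exact one_lt_aleph0.trans_le hreg.lift.aleph0_le

/-- The cone above an element of `P_κλ` is club. -/
theorem PklClub.cone {κ lam : Cardinal} (hreg : κ.IsRegular) {x : Set Ordinal}
    (hx : x ∈ Pkl κ lam) : PklClub κ lam {y | y ∈ Pkl κ lam ∧ x ⊆ y} := by
  refine ⟨⟨fun y hy => hy.1, fun y hy =>
    ⟨x ∪ y, ⟨Pkl.union_mem hreg hx hy, subset_union_left⟩, subset_union_right⟩⟩, ?_⟩
  intro o ho hoκ c hc _
  refine ⟨Pkl.biUnion_mem hreg ?_ fun i hi => (hc i hi).1,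
    (hc 0 ho).2.trans (subset_biUnion_of_mem (u := c) (mem_Iio.2 ho))⟩
  rw [mk_Iio_ordinal, lift_lt]
  exact lt_ord.1 hoκ

/-- Clubs in `P_κλ` are closed under unions of increasing `ω`-sequences. -/
theorem PklClub.iUnion_nat_mem {κ lam : Cardinal} (hκ : ℵ₀ < κ) {C : Set (Set Ordinal)}
    (hC : PklClub κ lam C) {s : ℕ → Set Ordinal} (hs : Monotone s) (hsC : ∀ n, s n ∈ C) :
    (⋃ n, s n) ∈ C := by
  let c : Ordinal → Set Ordinal := fun i => ⋃ (n : ℕ) (_ : (n : Ordinal) ≤ i), s n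
  have hcn (n : ℕ) : c n = s n := by
    refine Subset.antisymm (iUnion₂_subset fun m hm => hs (by exact_mod_cast hm)) ?_
    exact subset_iUnion₂_of_subset n le_rfl Subset.rfl
  have hω : (⋃ i ∈ Iio Ordinal.omega0, c i) = ⋃ n, s n := by
    refine Subset.antisymm (iUnion₂_subset fun i _ =>
      iUnion₂_subset fun n _ => subset_iUnion s n) (iUnion_subset fun n => ?_)
    rw [← hcn n]
    exact subset_biUnion_of_mem (u := c) (mem_Iio.2 (Ordinal.natCast_lt_omega0 n))
  rw [← hω]
  refine hC.2 _ Ordinal.omega0_pos (by rw [← ord_aleph0]; exact ord_lt_ord.2 hκ) c ?_ ?_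
  · intro i hi
    obtain ⟨n, rfl⟩ := Ordinal.lt_omega0.1 hi
    rw [hcn]
    exact hsC n
  · intro i j hij _
    exact iUnion₂_subset fun n hn => subset_iUnion₂_of_subset n (hn.trans hij) Subset.rfl

/-- If every `s n` lies below a member of the club `C` that lies below `s (n + 1)`, then the
union of the `s n` is in `C`. -/
theorem PklClub.iUnion_nat_mem_of_interleaved {κ lam : Cardinal} (hκ : ℵ₀ < κ)
    {C : Set (Set Ordinal)} (hC : PklClub κ lam C) {s t : ℕ → Set Ordinal}
    (htC : ∀ n, t n ∈ C) (hst : ∀ n, s n ⊆ t n) (hts : ∀ n, t n ⊆ s (n + 1)) :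
    (⋃ n, s n) ∈ C := by
  have h : (⋃ n, s n) = ⋃ n, t n :=
    Subset.antisymm (iUnion_mono hst)
      (iUnion_subset fun n => (hts n).trans (subset_iUnion s (n + 1)))
  rw [h]
  exact hC.iUnion_nat_mem hκ (monotone_nat_of_le_succ fun n => (hts n).trans (hst (n + 1))) htC

/-- Clubs in `P_κλ` are closed under diagonal intersections. -/
theorem PklClub.diagonal {κ lam : Cardinal} (hκ : ℵ₀ < κ) (hreg : κ.IsRegular)
    {D : Set (Set Ordinal)} (hD : PklClub κ lam D) {C : Ordinal → Set (Set Ordinal)}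
    (hC : ∀ β < lam.ord, PklClub κ lam (C β)) :
    PklClub κ lam {x | x ∈ D ∧ ∀ β ∈ x, x ∈ C β} := by
  refine ⟨⟨fun x hx => hD.1.1 hx.1, fun x hx => ?_⟩, ?_⟩
  · have hg : ∀ y, ∃ z, y ∈ Pkl κ lam → z ∈ D ∧ y ⊆ z := fun y => by
      by_cases hy : y ∈ Pkl κ lam
      · obtain ⟨z, hz⟩ := hD.1.2 y hy
        exact ⟨z, fun _ => hz⟩
      · exact ⟨∅, fun h => absurd h hy⟩
    have hf : ∀ β y, ∃ z, β < lam.ord → y ∈ Pkl κ lam → z ∈ C β ∧ y ⊆ z := fun β y => by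
      by_cases h : β < lam.ord ∧ y ∈ Pkl κ lam
      · obtain ⟨z, hz⟩ := (hC β h.1).1.2 y h.2
        exact ⟨z, fun _ _ => hz⟩
      · exact ⟨∅, fun h₁ h₂ => absurd ⟨h₁, h₂⟩ h⟩
    choose g hg using hg
    choose f hf using hf
    let F : Set Ordinal → Set Ordinal := fun y => g y ∪ ⋃ β ∈ y, f β y
    have hF : ∀ y ∈ Pkl κ lam, F y ∈ Pkl κ lam := fun y hy =>
      Pkl.union_mem hreg (hD.1.1 (hg y hy).1) (Pkl.biUnion_mem hreg hy.2 fun β hβ =>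
        (hC β (hy.1 hβ)).1.1 (hf β y (hy.1 hβ) hy).1)
    let s : ℕ → Set Ordinal := fun n => F^[n] x
    have hsucc (n : ℕ) : s (n + 1) = F (s n) := Function.iterate_succ_apply' F n x
    have hs (n : ℕ) : s n ∈ Pkl κ lam := by
      induction n with
      | zero => exact hx
      | succ n ih => rw [hsucc]; exact hF _ ih
    have hgs (n : ℕ) : g (s n) ⊆ s (n + 1) := by
      rw [hsucc]
      exact subset_union_left
    have hmono : Monotone s :=
      monotone_nat_of_le_succ fun n => (hg _ (hs n)).2.trans (hgs n)
    refine ⟨⋃ n, s n, ⟨?_, fun β hβ => ?_⟩, subset_iUnion s 0⟩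
    · exact hD.iUnion_nat_mem_of_interleaved hκ (fun n => (hg _ (hs n)).1)
        (fun n => (hg _ (hs n)).2) hgs
    · obtain ⟨m, hm⟩ := mem_iUnion.1 hβ
      have hβl : β < lam.ord := (hs m).1 hm
      rw [← hmono.iUnion_nat_add m]
      refine (hC β hβl).iUnion_nat_mem_of_interleaved hκ (t := fun n => f β (s (n + m)))
        (fun n => (hf β _ hβl (hs _)).1) (fun n => (hf β _ hβl (hs _)).2) fun n => ?_
      rw [Nat.add_right_comm, hsucc]
      exact (subset_biUnion_of_mem (u := fun β => f β (s (n + m)))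
        (hmono (Nat.le_add_left m n) hm)).trans subset_union_right
  · intro o ho hoκ c hc hmono
    refine ⟨hD.2 o ho hoκ c (fun i hi => (hc i hi).1) hmono, fun β hβ => ?_⟩
    obtain ⟨k, hk, hβk⟩ := mem_iUnion₂.1 hβ
    have hk : k < o := hk
    have hβl : β < lam.ord := (hD.1.1 (hc k hk).1).1 hβk
    have h : (⋃ i ∈ Iio o, c i) = ⋃ i ∈ Iio o, c (max i k) :=
      Subset.antisymm
        (iUnion₂_mono fun i hi => hmono _ _ (le_max_left i k) (max_lt hi hk))
        (iUnion₂_subset fun i hi =>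
          subset_biUnion_of_mem (u := c) (mem_Iio.2 (max_lt hi hk)))
    rw [h]
    refine (hC β hβl).2 o ho hoκ _ (fun i hi => ?_) fun i j hij hj =>
      hmono _ _ (max_le_max_right k hij) (max_lt hj hk)
    exact (hc _ (max_lt hi hk)).2 β (hmono _ _ (le_max_right i k) (max_lt hi hk) hβk)

theorem PklStat.inter_diagonal {κ lam : Cardinal} (hκ : ℵ₀ < κ) (hreg : κ.IsRegular)
    {S : Set (Set Ordinal)} (hS : PklStat κ lam S) {C : Ordinal → Set (Set Ordinal)}
    (hC : ∀ β < lam.ord, PklClub κ lam (C β)) :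
    PklStat κ lam {x | x ∈ S ∧ ∀ β ∈ x, x ∈ C β} := by
  refine ⟨fun x hx => hS.1 hx.1, fun D hD => ?_⟩
  obtain ⟨x, hxS, hxD, hx⟩ := hS.2 _ (hD.diagonal hκ hreg hC)
  exact ⟨x, ⟨hxS, hx⟩, hxD⟩

theorem PklStat.unbdd {κ lam : Cardinal} (hreg : κ.IsRegular) {S : Set (Set Ordinal)}
    (hS : PklStat κ lam S) : PklUnbdd κ lam S := by
  refine ⟨hS.1, fun x hx => ?_⟩
  obtain ⟨y, hyS, -, hxy⟩ := hS.2 _ (PklClub.cone hreg hx)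
  exact ⟨y, hyS, hxy⟩

theorem PklUnbdd.covering {κ lam : Cardinal} (hreg : κ.IsRegular) {U : Set (Set Ordinal)}
    (hU : PklUnbdd κ lam U) : PklCovering lam U := fun ξ hξ => by
  obtain ⟨y, hyU, hy⟩ := hU.2 _ (Pkl.singleton_mem hreg hξ)
  exact ⟨y, hyU, hy rfl⟩

/-- A stationary set which the list `d` does not split into stationary sets yields an
ineffable branch of `d`. -/
theorem PklStat.exists_ineffable_branch {κ lam : Cardinal} (hκ : ℵ₀ < κ) (hreg : κ.IsRegular)
    {d : Set Ordinal → Set Ordinal} (hd : ∀ x ∈ Pkl κ lam, d x ⊆ x)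
    {S : Set (Set Ordinal)} (hS : PklStat κ lam S)
    (hsplit : ∀ β < lam.ord, PklStat κ lam {x | x ∈ S ∧ β ∈ d x} →
      ¬ PklStat κ lam {x | x ∈ S ∧ β ∈ x ∧ β ∉ d x}) :
    ∃ B : Set Ordinal, B ⊆ Iio lam.ord ∧
      ∃ T, PklStat κ lam T ∧ ∀ x ∈ T, d x = B ∩ x := by
  have hclub : ∀ β, ∃ C, β < lam.ord → PklClub κ lam C ∧
      ((∀ x ∈ S, x ∈ C → β ∉ d x) ∨ ∀ x ∈ S, x ∈ C → β ∈ x → β ∈ d x) := by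
    intro β
    by_contra! hno
    obtain ⟨hβ, -⟩ := hno ∅
    refine hsplit β hβ ⟨fun x hx => hS.1 hx.1, fun C hC => ?_⟩
      ⟨fun x hx => hS.1 hx.1, fun C hC => ?_⟩
    · obtain ⟨x, hxS, hxC, hx⟩ := ((hno C).2 hC).1
      exact ⟨x, ⟨hxS, hx⟩, hxC⟩
    · obtain ⟨x, hxS, hxC, hx⟩ := ((hno C).2 hC).2
      exact ⟨x, ⟨hxS, hx⟩, hxC⟩
  choose C hC using hclub
  refine ⟨{β | β < lam.ord ∧ ∀ x ∈ S, x ∈ C β → β ∈ x → β ∈ d x}, fun β hβ => hβ.1, _,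
    hS.inter_diagonal hκ hreg fun β hβ => (hC β hβ).1, ?_⟩
  rintro x ⟨hxS, hxC⟩
  ext β
  constructor
  · intro hβ
    have hβx := hd x (hS.1 hxS) hβ
    have hβl : β < lam.ord := (hS.1 hxS).1 hβx
    exact ⟨⟨hβl, (hC β hβl).2.resolve_left fun h => h x hxS (hxC β hβx) hβ⟩, hβx⟩
  · rintro ⟨⟨-, h⟩, hβx⟩
    exact h x hxS (hxC β hβx) hβx

/-- For a regular uncountable `κ` and `λ ≥ κ` and a `P_κλ`-list `d`, the following are
equivalent: `d` splits every stationary set into stationary sets; into unbounded sets;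
into covering sets; into nonempty sets; `d` has no ineffable branch. -/
theorem pkl_stationary_split_tfae (κ lam : Cardinal) (hκ : ℵ₀ < κ)
    (hreg : κ.IsRegular) (hkl : κ ≤ lam)
    (d : Set Ordinal → Set Ordinal) (hd : ∀ x ∈ Pkl κ lam, d x ⊆ x) :
    [∀ S, PklStat κ lam S → ∃ β < lam.ord,
        PklStat κ lam {x | x ∈ S ∧ β ∈ d x} ∧ PklStat κ lam {x | x ∈ S ∧ β ∈ x ∧ β ∉ d x},
      ∀ S, PklStat κ lam S → ∃ β < lam.ord,
        PklUnbdd κ lam {x | x ∈ S ∧ β ∈ d x} ∧ PklUnbdd κ lam {x | x ∈ S ∧ β ∈ x ∧ β ∉ d x},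
      ∀ S, PklStat κ lam S → ∃ β < lam.ord,
        PklCovering lam {x | x ∈ S ∧ β ∈ d x} ∧ PklCovering lam {x | x ∈ S ∧ β ∈ x ∧ β ∉ d x},
      ∀ S, PklStat κ lam S → ∃ β < lam.ord,
        {x | x ∈ S ∧ β ∈ d x}.Nonempty ∧ {x | x ∈ S ∧ β ∈ x ∧ β ∉ d x}.Nonempty,
      ¬ ∃ B : Set Ordinal, B ⊆ Set.Iio lam.ord ∧
          ∃ S, PklStat κ lam S ∧ ∀ x ∈ S, d x = B ∩ x].TFAE := by
  tfae_have 1 → 2 := fun h S hS => by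
    obtain ⟨β, hβ, h₁, h₂⟩ := h S hS
    exact ⟨β, hβ, h₁.unbdd hreg, h₂.unbdd hreg⟩
  tfae_have 2 → 3 := fun h S hS => by
    obtain ⟨β, hβ, h₁, h₂⟩ := h S hS
    exact ⟨β, hβ, h₁.covering hreg, h₂.covering hreg⟩
  tfae_have 3 → 4 := fun h S hS => by
    obtain ⟨β, hβ, h₁, h₂⟩ := h S hS
    obtain ⟨x, hx, -⟩ := h₁ β hβ
    obtain ⟨y, hy, -⟩ := h₂ β hβ
    exact ⟨β, hβ, ⟨x, hx⟩, ⟨y, hy⟩⟩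
  tfae_have 4 → 5 := by
    rintro h ⟨B, -, S, hS, hB⟩
    obtain ⟨β, -, ⟨x, hxS, hx⟩, ⟨y, hyS, hβy, hy⟩⟩ := h S hS
    rw [hB x hxS] at hx
    rw [hB y hyS] at hy
    exact hy ⟨hx.1, hβy⟩
  tfae_have 5 → 1 := fun h S hS => by
    by_contra! hno
    exact h (hS.exists_ineffable_branch hκ hreg hd hno)
  tfae_finish
end

section
/- Let κ be a regular uncountable cardinal, λ ≥ κ a cardinal, d a P_κλ-list, and 𝓘 a normal ideal on P_κλ. The following are equivalent: (1) for every S ∈ 𝓘⁺ there is β<λ with both S⁺_β ∈ 𝓘⁺ and S⁻_β ∈ 𝓘⁺; (2) for every S ∈ 𝓘⁺ there is β<λ with both S⁺_β and S⁻_β nonempty; (3) d has no 𝓘⁺-branch, i.e., there is no B ⊆ λ together with S ∈ 𝓘⁺ such that d_x = B ∩ x for all x ∈ S. -/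
open Cardinal Set

/-- The `𝓘`-positive subsets of `P_κλ`. -/
def IdealPos (κ lam : Cardinal) (I : Set (Set (Set Ordinal))) : Set (Set (Set Ordinal)) :=
  {S | S ⊆ Pkl κ lam ∧ S ∉ I}

/-- For a normal ideal `𝓘` on `P_κλ` and a `P_κλ`-list `d`, the following are equivalent:
`d` splits every `𝓘`-positive set into `𝓘`-positive sets; into nonempty sets;
`d` has no `𝓘⁺`-branch. -/
theorem pkl_normal_ideal_split_tfae (κ lam : Cardinal) (hκ : ℵ₀ < κ)
    (hreg : κ.IsRegular) (hkl : κ ≤ lam)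
    (d : Set Ordinal → Set Ordinal) (hd : ∀ x ∈ Pkl κ lam, d x ⊆ x)
    (I : Set (Set (Set Ordinal)))
    (hsub : ∀ X ∈ I, X ⊆ Pkl κ lam)
    (hdown : ∀ X Y : Set (Set Ordinal), X ⊆ Y → Y ∈ I → X ∈ I)
    (hunion : ∀ X ∈ I, ∀ Y ∈ I, X ∪ Y ∈ I)
    (hproper : Pkl κ lam ∉ I)
    (hnonunb : ∀ X, X ⊆ Pkl κ lam → ¬ PklUnbdd κ lam X → X ∈ I)
    (hdiag : ∀ X : Ordinal → Set (Set Ordinal), (∀ ν < lam.ord, X ν ∈ I) →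
      {x | x ∈ Pkl κ lam ∧ ∃ ν ∈ x, x ∈ X ν} ∈ I) :
    [∀ S ∈ IdealPos κ lam I, ∃ β < lam.ord,
        {x | x ∈ S ∧ β ∈ d x} ∈ IdealPos κ lam I ∧
        {x | x ∈ S ∧ β ∈ x ∧ β ∉ d x} ∈ IdealPos κ lam I,
      ∀ S ∈ IdealPos κ lam I, ∃ β < lam.ord,
        {x | x ∈ S ∧ β ∈ d x}.Nonempty ∧ {x | x ∈ S ∧ β ∈ x ∧ β ∉ d x}.Nonempty,
      ¬ ∃ B : Set Ordinal, B ⊆ Set.Iio lam.ord ∧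
          ∃ S ∈ IdealPos κ lam I, ∀ x ∈ S, d x = B ∩ x].TFAE := by
  have empty_mem : (∅ : Set (Set Ordinal)) ∈ I := by
    refine hnonunb ∅ (Set.empty_subset _) fun h => ?_
    have h0 : (∅ : Set Ordinal) ∈ Pkl κ lam :=
      ⟨Set.empty_subset _, by simpa using hreg.pos⟩
    obtain ⟨y, hy, -⟩ := h.2 ∅ h0
    exact hy
  have pos_nonempty : ∀ S ∈ IdealPos κ lam I, S.Nonempty := by
    intro S hS
    by_contra hE
    rw [Set.not_nonempty_iff_eq_empty] at hE
    exact hS.2 (hE ▸ empty_mem)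
  tfae_have 1 → 2 := by
    intro h S hS
    obtain ⟨β, hβ, h₁, h₂⟩ := h S hS
    exact ⟨β, hβ, pos_nonempty _ h₁, pos_nonempty _ h₂⟩
  tfae_have 2 → 3 := by
    rintro h ⟨B, -, S, hS, hB⟩
    obtain ⟨β, -, ⟨x, hx, hβx⟩, ⟨y, hy, hβy, hβdy⟩⟩ := h S hS
    rw [hB x hx] at hβx
    rw [hB y hy] at hβdy
    exact hβdy ⟨hβx.1, hβy⟩
  tfae_have 3 → 1 := by
    intro h S hS
    by_contra! hsplit
    classical
    let B : Set Ordinal := {β | β < lam.ord ∧ {x | x ∈ S ∧ β ∈ x ∧ β ∉ d x} ∈ I}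
    let X : Ordinal → Set (Set Ordinal) := fun β =>
      if β ∈ B then {x | x ∈ S ∧ β ∈ x ∧ β ∉ d x} else {x | x ∈ S ∧ β ∈ d x}
    have hX : ∀ ν < lam.ord, X ν ∈ I := by
      intro ν hν
      by_cases hνB : ν ∈ B
      · simpa only [X, if_pos hνB] using hνB.2
      · simp only [X, if_neg hνB]
        by_contra hpos
        refine hsplit ν hν ⟨fun x hx => hS.1 hx.1, hpos⟩ ⟨fun x hx => hS.1 hx.1, fun hmem => ?_⟩
        exact hνB ⟨hν, hmem⟩
    have hD := hdiag X hX
    refine h ⟨B, fun β hβ => hβ.1, S \ {x | x ∈ Pkl κ lam ∧ ∃ ν ∈ x, x ∈ X ν},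
      ⟨fun x hx => hS.1 hx.1, fun hT => hS.2 (hdown _ _ ?_ (hunion _ hT _ hD))⟩, ?_⟩
    · rw [Set.sdiff_union_self]
      exact Set.subset_union_left
    · rintro x ⟨hxS, hxD⟩
      have hnot : ∀ ν ∈ x, x ∉ X ν := fun ν hν hxν => hxD ⟨hS.1 hxS, ν, hν, hxν⟩
      ext β
      constructor
      · intro hβ
        have hβx := hd x (hS.1 hxS) hβ
        refine ⟨?_, hβx⟩
        by_contra hβB
        exact hnot β hβx (by simpa only [X, if_neg hβB, Set.mem_ofPred_eq] using And.intro hxS hβ)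
      · rintro ⟨hβB, hβx⟩
        by_contra hβ
        exact hnot β hβx (by
          simpa only [X, if_pos hβB, Set.mem_ofPred_eq] using And.intro hxS (And.intro hβx hβ))
  tfae_finish
end

section
/- Let κ be a regular uncountable cardinal and λ ≥ κ a cardinal. If the partition property Part(κ,λ)³ holds, then every P_κλ-list has a strong branch (i.e., κ is wildly λ-ineffable). -/
open Cardinal Set

/-- `B` is a strong branch of the `P_κλ`-list `d`. -/
def PklStrongBranch (κ lam : Cardinal) (d : Set Ordinal → Set Ordinal)
    (B : Set Ordinal) : Prop :=
  B ⊆ Set.Iio lam.ord ∧ ∃ U, PklUnbdd κ lam U ∧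
    ∀ x ∈ Pkl κ lam, ∃ y ∈ Pkl κ lam, x ⊆ y ∧
      ∀ z ∈ U, y ⊆ z → d z ∩ x = B ∩ x

/-- `A` precedes or equals `B` in the lexicographic order: the least element of the symmetric
difference, if any, belongs to `B`. -/
def LexLE {ι : Type*} [LinearOrder ι] (A B : Set ι) : Prop :=
  ∀ i, (∀ j < i, j ∈ A ↔ j ∈ B) → i ∈ A → i ∈ B

theorem LexLE.refl {ι : Type*} [LinearOrder ι] (A : Set ι) : LexLE A A :=
  fun _ _ h => h

theorem LexLE.of_not {ι : Type*} [LinearOrder ι] {A B : Set ι} (h : ¬ LexLE A B) :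
    LexLE B A := by
  simp only [LexLE, not_forall] at h
  obtain ⟨i, hi, hA, hB⟩ := h
  intro j hj hjB
  rcases lt_trichotomy i j with hij | rfl | hij
  · exact absurd ((hj i hij).2 hA) hB
  · exact hA
  · exact (hi j hij).2 hjB

/-- A map into `𝒫 s` which is monotone or antitone for the lexicographic order is eventually
constant as soon as families indexed by the elements of `s` are bounded above in the domain. -/
theorem exists_forall_ge_eq_of_lexLE {ι α : Type*} [LinearOrder ι] [WellFoundedLT ι] [Preorder α]
    [Nonempty α] {s : Set ι} {e : α → Set ι} (hs : ∀ a, e a ⊆ s)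
    (hdir : ∀ f : s → α, ∃ b, ∀ i, f i ≤ b)
    (hmono : (∀ a b, a ≤ b → LexLE (e a) (e b)) ∨ ∀ a b, a ≤ b → LexLE (e b) (e a)) :
    ∃ a, ∀ b, a ≤ b → e b = e a := by
  have key : ∀ i : s, ∃ a, ∀ b, a ≤ b → (i.1 ∈ e b ↔ i.1 ∈ e a) := by
    intro i
    induction i using WellFoundedLT.induction with
    | ind i ih =>
    have ih' : ∀ j : s, ∃ a, j < i → ∀ b, a ≤ b → (j.1 ∈ e b ↔ j.1 ∈ e a) := fun j => by
      by_cases hj : j < i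
      · exact (ih j hj).imp fun _ h _ => h
      · exact ⟨Classical.arbitrary α, fun h => absurd h hj⟩
    choose f hf using ih'
    obtain ⟨a, ha⟩ := hdir f
    have agree : ∀ b c, a ≤ b → a ≤ c → ∀ j < i.1, j ∈ e b ↔ j ∈ e c := by
      intro b c hb hc j hj
      by_cases hjs : j ∈ s
      · rw [hf ⟨j, hjs⟩ hj b ((ha _).trans hb), hf ⟨j, hjs⟩ hj c ((ha _).trans hc)]
      · exact iff_of_false (fun h => hjs (hs b h)) (fun h => hjs (hs c h))
    rcases hmono with hmono | hmono
    · by_cases h : ∃ b, a ≤ b ∧ i.1 ∈ e b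
      · obtain ⟨b, hab, hb⟩ := h
        exact ⟨b, fun c hbc => iff_of_true
          (hmono b c hbc i (agree b c hab (hab.trans hbc)) hb) hb⟩
      · push Not at h
        exact ⟨a, fun b hab => iff_of_false (h b hab) (h a le_rfl)⟩
    · by_cases h : ∃ b, a ≤ b ∧ i.1 ∉ e b
      · obtain ⟨b, hab, hb⟩ := h
        exact ⟨b, fun c hbc => iff_of_false
          (fun hc => hb (hmono b c hbc i (agree c b (hab.trans hbc) hab) hc)) hb⟩
      · push Not at h
        exact ⟨a, fun b hab => iff_of_true (h b hab) (h a le_rfl)⟩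
  choose f hf using key
  obtain ⟨a, ha⟩ := hdir f
  refine ⟨a, fun b hab => Set.ext fun i => ?_⟩
  by_cases hi : i ∈ s
  · rw [hf ⟨i, hi⟩ b ((ha _).trans hab), hf ⟨i, hi⟩ a (ha _)]
  · exact iff_of_false (fun h => hi (hs b h)) (fun h => hi (hs a h))

theorem iUnion_mem_Pkl {κ lam : Cardinal} (hreg : κ.IsRegular) {ι : Type 1} {f : ι → Set Ordinal}
    (hι : #ι < Cardinal.lift.{1, 0} κ) (hf : ∀ i, f i ∈ Pkl κ lam) :
    ⋃ i, f i ∈ Pkl κ lam :=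
  ⟨iUnion_subset fun i => (hf i).1,
    (card_iUnion_lt_iff_forall_of_isRegular hreg.lift hι).2 fun i => (hf i).2⟩

theorem union_mem_Pkl {κ lam : Cardinal} (hκ : ℵ₀ ≤ κ) {x y : Set Ordinal}
    (hx : x ∈ Pkl κ lam) (hy : y ∈ Pkl κ lam) : x ∪ y ∈ Pkl κ lam :=
  ⟨union_subset hx.1 hy.1,
    (mk_union_le x y).trans_lt (add_lt_of_lt (aleph0_le_lift.2 hκ) hx.2 hy.2)⟩

theorem PklUnbdd.exists_ssuperset {κ lam : Cardinal} {H : Set (Set Ordinal)} (hκ : ℵ₀ ≤ κ)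
    (hkl : κ ≤ lam) (hH : PklUnbdd κ lam H) {x : Set Ordinal} (hx : x ∈ Pkl κ lam) :
    ∃ y ∈ H, x ⊂ y := by
  obtain ⟨o, ho, hox⟩ : ∃ o ∈ Set.Iio lam.ord, o ∉ x := by
    by_contra! h
    have h1 := (mk_le_mk_of_subset (show Set.Iio lam.ord ⊆ x from h)).trans_lt hx.2
    rw [mk_Iio_ordinal, card_ord] at h1
    exact (lift_lt.1 h1).not_ge hkl
  have hoP : ({o} : Set Ordinal) ∈ Pkl κ lam := by
    refine ⟨singleton_subset_iff.2 ho, ?_⟩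
    rw [mk_singleton]
    exact one_lt_aleph0.trans_le (aleph0_le_lift.2 hκ)
  obtain ⟨y, hyH, hy⟩ := hH.2 _ (union_mem_Pkl hκ hx hoP)
  exact ⟨y, hyH, ssubset_of_subset_not_subset (subset_union_left.trans hy)
    fun h => hox (h (hy (Or.inr rfl)))⟩

/-- If the restrictions of a list to each member of an unbounded set stabilize along that set,
then the list has a strong branch. -/
theorem PklUnbdd.exists_strongBranch {κ lam : Cardinal} {H : Set (Set Ordinal)} (hκ : ℵ₀ ≤ κ)
    (hH : PklUnbdd κ lam H) {d : Set Ordinal → Set Ordinal} (hd : ∀ x ∈ Pkl κ lam, d x ⊆ x)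
    (hstab : ∀ a ∈ H, ∃ y ∈ H, a ⊆ y ∧ ∀ z ∈ H, y ⊆ z → d z ∩ a = d y ∩ a) :
    ∃ B, PklStrongBranch κ lam d B := by
  refine ⟨{i | ∃ y ∈ H, ∀ z ∈ H, y ⊆ z → i ∈ d z}, ?_, H, hH, fun x hx => ?_⟩
  · rintro i ⟨y, hy, h⟩
    exact (hH.1 hy).1 (hd y (hH.1 hy) (h y hy subset_rfl))
  · obtain ⟨a, haH, hxa⟩ := hH.2 x hx
    obtain ⟨y, hyH, hay, hy⟩ := hstab a haH
    refine ⟨y, hH.1 hyH, hxa.trans hay, fun z hz hyz => Set.ext fun i =>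
      and_congr_left fun hix => ?_⟩
    have hmem : ∀ w ∈ H, y ⊆ w → (i ∈ d w ↔ i ∈ d y) := fun w hw hyw => by
      simpa [hxa hix] using Set.ext_iff.1 (hy w hw hyw) i
    constructor
    · intro hi
      exact ⟨y, hyH, fun w hw hyw => (hmem w hw hyw).2 ((hmem z hz hyz).1 hi)⟩
    · rintro ⟨y', hy'H, hy'⟩
      obtain ⟨w, hw, hyw⟩ := hH.2 _ (union_mem_Pkl hκ (hH.1 hyH) (hH.1 hy'H))
      rw [hmem z hz hyz, ← hmem w hw (subset_union_left.trans hyw)]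
      exact hy' w hw (subset_union_right.trans hyw)

/-- If the partition property `Part(κ,λ)³` holds (every `2`-coloring of ⊊-increasing
triples from `P_κλ` has an unbounded homogeneous set), then every `P_κλ`-list has a
strong branch, i.e. `κ` is wildly `λ`-ineffable. -/
theorem part3_implies_wildly_ineffable (κ lam : Cardinal) (hκ : ℵ₀ < κ)
    (hreg : κ.IsRegular) (hkl : κ ≤ lam)
    (hpart : ∀ F : Set Ordinal → Set Ordinal → Set Ordinal → Bool,
      ∃ H, PklUnbdd κ lam H ∧ ∃ c : Bool, ∀ a₀ a₁ a₂ : Set Ordinal,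
        a₀ ∈ H → a₁ ∈ H → a₂ ∈ H → a₀ ⊂ a₁ → a₁ ⊂ a₂ → F a₀ a₁ a₂ = c) :
    ∀ d : Set Ordinal → Set Ordinal, (∀ x ∈ Pkl κ lam, d x ⊆ x) →
      ∃ B : Set Ordinal, PklStrongBranch κ lam d B := by
  classical
  intro d hd
  obtain ⟨H, hH, c, hc⟩ := hpart fun a₀ a₁ a₂ => decide (LexLE (d a₁ ∩ a₀) (d a₂ ∩ a₀))
  refine hH.exists_strongBranch hκ.le hd fun a ha => ?_
  obtain ⟨a', ha'H, haa'⟩ := hH.exists_ssuperset hκ.le hkl (hH.1 ha)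
  let α := {z // z ∈ H ∧ a ⊂ z}
  have : Nonempty α := ⟨⟨a', ha'H, haa'⟩⟩
  have hdir : ∀ f : a → α, ∃ b, ∀ i, f i ≤ b := fun f => by
    obtain ⟨y, hyH, hy⟩ := hH.2 _ (union_mem_Pkl hκ.le (hH.1 ha'H)
      (iUnion_mem_Pkl hreg (hH.1 ha).2 fun i => hH.1 (f i).2.1))
    exact ⟨⟨y, hyH, haa'.trans_subset (subset_union_left.trans hy)⟩, fun i =>
      (subset_iUnion (fun i => (f i).1) i).trans (subset_union_right.trans hy)⟩
  have hmono : (∀ b b' : α, b ≤ b' → LexLE (d b ∩ a) (d b' ∩ a)) ∨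
      ∀ b b' : α, b ≤ b' → LexLE (d b' ∩ a) (d b ∩ a) := by
    cases c
    · refine Or.inr fun b b' hbb' => ?_
      rcases hbb'.eq_or_lt with rfl | hlt
      · exact LexLE.refl _
      · exact LexLE.of_not (of_decide_eq_false (hc a b b' ha b.2.1 b'.2.1 b.2.2 hlt))
    · refine Or.inl fun b b' hbb' => ?_
      rcases hbb'.eq_or_lt with rfl | hlt
      · exact LexLE.refl _
      · exact of_decide_eq_true (hc a b b' ha b.2.1 b'.2.1 b.2.2 hlt)
  obtain ⟨y, hy⟩ := exists_forall_ge_eq_of_lexLE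
    (e := fun b : α => d b ∩ a) (fun _ => inter_subset_right) hdir hmono
  exact ⟨y, y.2.1, y.2.2.subset, fun z hz hyz => hy ⟨z, hz, y.2.2.trans_subset hyz⟩ hyz⟩
end
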